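/- Let X be a complex Banach space and H a complex Hilbert space, and let j_X : X → (𝔻 → ℂ) and j_H : H → (𝔻 → ℂ) be injective linear maps whose images consist of analytic functions on 𝔻 and such that, for every z ∈ 𝔻, the evaluation functionals x ↦ j_X(x)(z) on X and v ↦ j_H(v)(z) on H are continuous. Assume j_X(X) ⊆ j_H(H) as sets of functions. Let f : 𝔻 → ℂ and suppose there exists a sequence (x_n) in X with sup_n ‖x_n‖_X < ∞ such that j_X(x_n)(z) → f(z) for every z ∈ 𝔻. Then f ∈ j_H(H). -/

import Mathlib

open Metric Filter

/-- A bounded family in a Hilbert space converges weakly along every ultrafilter. -/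
theorem exists_weak_limit_of_norm_le {ι H : Type*} [NormedAddCommGroup H]
    [InnerProductSpace ℂ H] [CompleteSpace H] (U : Ultrafilter ι) (v : ι → H) (C : ℝ)
    (hv : ∀ i, ‖v i‖ ≤ C) :
    ∃ w : H, ∀ φ : StrongDual ℂ H, Tendsto (fun i => φ (v i)) U (nhds (φ w)) := by
  let u : ι → WeakDual ℂ H := fun i => StrongDual.toWeakDual (InnerProductSpace.toDual ℂ H (v i))
  obtain ⟨ψ, -, hψ⟩ := (WeakDual.isCompact_closedBall (𝕜 := ℂ) (E := H) 0 C).ultrafilter_le_nhds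
    (U.map u) (by
      rw [le_principal_iff, Ultrafilter.coe_map, mem_map]
      refine Eventually.of_forall fun i => mem_closedBall_zero_iff.2 ?_
      exact ((InnerProductSpace.toDual ℂ H).norm_map (v i)).trans_le (hv i))
  refine ⟨(InnerProductSpace.toDual ℂ H).symm (WeakDual.toStrongDual ψ), fun φ => ?_⟩
  have hlim : Tendsto (fun i => u i ((InnerProductSpace.toDual ℂ H).symm φ)) U
      (nhds (ψ ((InnerProductSpace.toDual ℂ H).symm φ))) :=
    ((WeakDual.eval_continuous _).tendsto ψ).comp hψ
  have hconj := (Complex.continuous_conj.tendsto _).comp hlim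
  have hφ (a : H) : φ a =
      starRingEnd ℂ (inner ℂ a ((InnerProductSpace.toDual ℂ H).symm φ)) := by
    rw [inner_conj_symm, InnerProductSpace.toDual_symm_apply]
  simp_rw [hφ, InnerProductSpace.toDual_symm_apply]
  exact hconj

/-- Let `X` be a Banach space and `H` a Hilbert space of analytic functions on the unit disk
`𝔻`, realized via injective linear maps `jX`, `jH` into the analytic functions on `𝔻` with
continuous point evaluations (injectivity, containment and equalities of functions are all
understood on `𝔻`).  If `jX(X) ⊆ jH(H)` and `f : 𝔻 → ℂ` is the pointwise limit on `𝔻` of a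
norm-bounded sequence from `X`, then `f ∈ jH(H)`. -/
theorem stmt_19
    {X : Type*} [NormedAddCommGroup X] [NormedSpace ℂ X] [CompleteSpace X]
    {H : Type*} [NormedAddCommGroup H] [InnerProductSpace ℂ H] [CompleteSpace H]
    (jX : X →ₗ[ℂ] (ℂ → ℂ)) (jH : H →ₗ[ℂ] (ℂ → ℂ))
    (hanX : ∀ x : X, DifferentiableOn ℂ (jX x) (ball (0 : ℂ) 1))
    (hanH : ∀ v : H, DifferentiableOn ℂ (jH v) (ball (0 : ℂ) 1))
    (hinjX : ∀ x y : X, Set.EqOn (jX x) (jX y) (ball (0 : ℂ) 1) → x = y)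
    (hinjH : ∀ v w : H, Set.EqOn (jH v) (jH w) (ball (0 : ℂ) 1) → v = w)
    (hevX : ∀ z ∈ ball (0 : ℂ) 1, Continuous fun x : X => jX x z)
    (hevH : ∀ z ∈ ball (0 : ℂ) 1, Continuous fun v : H => jH v z)
    (hsub : ∀ x : X, ∃ v : H, Set.EqOn (jX x) (jH v) (ball (0 : ℂ) 1))
    (f : ℂ → ℂ) (x : ℕ → X) (M : ℝ) (hbdd : ∀ n, ‖x n‖ ≤ M)
    (hlim : ∀ z ∈ ball (0 : ℂ) 1,
      Tendsto (fun n => jX (x n) z) atTop (nhds (f z))) :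
    ∃ v : H, Set.EqOn f (jH v) (ball (0 : ℂ) 1) := by
  choose T hT using hsub
  let L : X →ₗ[ℂ] H :=
    { toFun := T
      map_add' := fun a b => hinjH _ _ fun z hz => by
        simp [← hT _ hz]
      map_smul' := fun c a => hinjH _ _ fun z hz => by
        simp [← hT _ hz] }
  have hL (a : X) {z : ℂ} (hz : z ∈ ball (0 : ℂ) 1) : jX a z = jH (L a) z := hT a hz
  let A : X →L[ℂ] H := ContinuousLinearMap.ofSeqClosedGraph (g := L) fun u a b hu hb =>
    hinjH _ _ fun z hz => by
      have hX := ((hevX z hz).tendsto a).comp hu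
      have hH := ((hevH z hz).tendsto b).comp hb
      rw [← hL a hz]
      exact tendsto_nhds_unique hH (hX.congr fun n => hL (u n) hz)
  obtain ⟨w, hw⟩ := exists_weak_limit_of_norm_le (hyperfilter ℕ) (fun n => A (x n)) (‖A‖ * M)
    fun n => A.le_opNorm_of_le (hbdd n)
  refine ⟨w, fun z hz => ?_⟩
  let φ : StrongDual ℂ H := ⟨(LinearMap.proj z).comp jH, hevH z hz⟩
  refine tendsto_nhds_unique ?_ (hw φ)
  exact ((hlim z hz).mono_left Nat.hyperfilter_le_atTop).congr fun n => hL (x n) hz
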